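/- (General regret bound for RHIG, Theorem 1.) Under Assumptions 1 and 2, fix W ≥ 0, stepsize η = 1/(2L), prediction-error vectors δ(1),…,δ(T) ∈ ℝ^{pT} with the convention δ(j) := δ(T) for j > T, and an initialization x(0) ∈ X^T (produced by an arbitrary oracle φ). Define the RHIG iterates x(k) = Π_{X^T}[x(k−1) − η ∇_x C(x(k−1); θ − δ(W−k+1))] for k = 1,…,W, assuming θ − δ(j) ∈ Θ^T for all j. Then the dynamic regret of the output x(W) satisfies C(x(W); θ) − C(x*; θ) ≤ (2L/α) ρ^W [C(x(0); θ) − C(x*; θ)] + ζ Σ_{k=1}^{min(W,T)} ρ^{k−1} ||δ(k)||² + 1_{(W>T)} · ζ (ρ^T − ρ^W)/(1 − ρ) · ||δ(T)||², where x* = argmin_{x ∈ X^T} C(x; θ), ρ = 1 − α/(4L), and ζ = h²/α + h²/(2L). -/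

import Mathlib

open Finset
open scoped RealInnerProductSpace

noncomputable section

/-- The total SOCO cost `C(x; θ) = ∑_{t=1}^T [f(x_t; θ_t) + d(x_t, x_{t-1})]`,
where the initial point is `x 0`. -/
def socoCost {n p : ℕ} (T : ℕ)
    (f : EuclideanSpace ℝ (Fin n) → EuclideanSpace ℝ (Fin p) → ℝ)
    (d : EuclideanSpace ℝ (Fin n) → EuclideanSpace ℝ (Fin n) → ℝ)
    (θ : ℕ → EuclideanSpace ℝ (Fin p)) (x : ℕ → EuclideanSpace ℝ (Fin n)) : ℝ :=
  ∑ t ∈ Finset.Icc 1 T, (f (x t) (θ t) + d (x t) (x (t - 1)))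

/-- The partial gradient of the total cost with respect to `x_t`:
`∇_{x_t} C(x;θ) = ∇_{x_t} f(x_t;θ_t) + ∇_{x_t} d(x_t,x_{t-1}) + ∇_{x_t} d(x_{t+1},x_t)·1_{t ≤ T-1}`,
where `Gf` is the gradient of `f` in its first argument and `Gd1`, `Gd2` are the partial
gradients of `d` in its first and second arguments. -/
def socoGrad {n p : ℕ} (T : ℕ)
    (Gf : EuclideanSpace ℝ (Fin n) → EuclideanSpace ℝ (Fin p) → EuclideanSpace ℝ (Fin n))
    (Gd1 Gd2 : EuclideanSpace ℝ (Fin n) → EuclideanSpace ℝ (Fin n) → EuclideanSpace ℝ (Fin n))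
    (θ : ℕ → EuclideanSpace ℝ (Fin p)) (x : ℕ → EuclideanSpace ℝ (Fin n)) (t : ℕ) :
    EuclideanSpace ℝ (Fin n) :=
  Gf (x t) (θ t) + Gd1 (x t) (x (t - 1)) + (if t < T then Gd2 (x (t + 1)) (x t) else 0)

theorem nonneg_of_forall_add_mul_nonneg {P Q : ℝ}
    (hPQ : ∀ s : ℝ, 0 < s → s < 1 → 0 ≤ P + s * Q) : 0 ≤ P := by
  have htend : Filter.Tendsto (fun s : ℝ => P + s * Q) (nhdsWithin 0 (Set.Ioi 0)) (nhds P) := by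
    have hcont : Continuous fun s : ℝ => P + s * Q := by fun_prop
    simpa using (hcont.tendsto 0).mono_left nhdsWithin_le_nhds
  refine ge_of_tendsto htend ?_
  filter_upwards [Ioo_mem_nhdsGT (zero_lt_one (α := ℝ))] with s hs
  exact hPQ s hs.1 hs.2

section InnerProductSpace

variable {E : Type*} [NormedAddCommGroup E] [InnerProductSpace ℝ E]

theorem inner_le_sq_div_add (e v : E) {α : ℝ} (hα : 0 < α) :
    ⟪e, v⟫ ≤ ‖e‖ ^ 2 / α + α / 4 * ‖v‖ ^ 2 := by
  have h₁ := real_inner_le_norm e v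
  have h₂ : ‖e‖ ^ 2 / α + α / 4 * ‖v‖ ^ 2 - ‖e‖ * ‖v‖ = (‖e‖ - α / 2 * ‖v‖) ^ 2 / α := by
    field_simp
    ring
  have h₃ : 0 ≤ (‖e‖ - α / 2 * ‖v‖) ^ 2 / α := by positivity
  linarith

theorem inner_add_inner_le_of_sq_add_sq_le (g₁ g₂ v₁ v₂ : E) {l : ℝ} (hl : 0 ≤ l)
    (hg : ‖g₁‖ ^ 2 + ‖g₂‖ ^ 2 ≤ l ^ 2 * (‖v₁‖ ^ 2 + ‖v₂‖ ^ 2)) :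
    ⟪g₁, v₁⟫ + ⟪g₂, v₂⟫ ≤ l * (‖v₁‖ ^ 2 + ‖v₂‖ ^ 2) := by
  have h₁ := real_inner_le_norm g₁ v₁
  have h₂ := real_inner_le_norm g₂ v₂
  have h₃ : ‖g₁‖ * ‖v₁‖ + ‖g₂‖ * ‖v₂‖ ≤ l * (‖v₁‖ ^ 2 + ‖v₂‖ ^ 2) := by
    refine abs_le_of_sq_le_sq' ?_ (by positivity) |>.2
    nlinarith [sq_nonneg (‖g₁‖ * ‖v₂‖ - ‖g₂‖ * ‖v₁‖),
      mul_le_mul_of_nonneg_right hg (by positivity : 0 ≤ ‖v₁‖ ^ 2 + ‖v₂‖ ^ 2)]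
  linarith

/-- The obtuse-angle inequality for a nearest point of a convex product set. -/
theorem sum_norm_sq_add_le_of_nearest {ι : Type*} (S : Finset ι) (a c y : ι → E)
    (hmin : ∀ s : ℝ, 0 < s → s < 1 →
      ∑ t ∈ S, ‖a t - c t‖ ^ 2 ≤ ∑ t ∈ S, ‖a t + s • (y t - a t) - c t‖ ^ 2) :
    ∑ t ∈ S, ‖a t - c t‖ ^ 2 + ∑ t ∈ S, ‖y t - a t‖ ^ 2 ≤ ∑ t ∈ S, ‖y t - c t‖ ^ 2 := by
  have hexp : ∀ s : ℝ, ∑ t ∈ S, ‖a t + s • (y t - a t) - c t‖ ^ 2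
      = ∑ t ∈ S, ‖a t - c t‖ ^ 2 + 2 * s * ∑ t ∈ S, ⟪a t - c t, y t - a t⟫
        + s ^ 2 * ∑ t ∈ S, ‖y t - a t‖ ^ 2 := by
    intro s
    rw [Finset.mul_sum, Finset.mul_sum, ← Finset.sum_add_distrib, ← Finset.sum_add_distrib]
    refine Finset.sum_congr rfl fun t _ => ?_
    rw [show a t + s • (y t - a t) - c t = (a t - c t) + s • (y t - a t) by abel,
      norm_add_sq_real, inner_smul_right, norm_smul, mul_pow, Real.norm_eq_abs, sq_abs]
    ring
  have hP : 0 ≤ 2 * ∑ t ∈ S, ⟪a t - c t, y t - a t⟫ := by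
    refine nonneg_of_forall_add_mul_nonneg (Q := ∑ t ∈ S, ‖y t - a t‖ ^ 2) fun s hs hs1 => ?_
    have := hmin s hs hs1
    rw [hexp] at this
    refine nonneg_of_mul_nonneg_right (a := s) ?_ hs
    linarith
  have h1 := hexp 1
  simp only [one_smul, add_sub_cancel] at h1
  rw [h1]
  linarith

/-- The three-point inequality for a projected gradient step of length `1 / (2 * L)`. -/
theorem sum_inner_add_le_of_projected_step {ι : Type*} (S : Finset ι) (a x g y : ι → E)
    {L : ℝ} (hL : 0 < L)
    (hmin : ∀ s : ℝ, 0 < s → s < 1 →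
      ∑ t ∈ S, ‖a t - (x t - (1 / (2 * L)) • g t)‖ ^ 2
        ≤ ∑ t ∈ S, ‖a t + s • (y t - a t) - (x t - (1 / (2 * L)) • g t)‖ ^ 2) :
    ∑ t ∈ S, ⟪g t, a t - x t⟫ + L * ∑ t ∈ S, ‖a t - x t‖ ^ 2 + L * ∑ t ∈ S, ‖y t - a t‖ ^ 2
      ≤ ∑ t ∈ S, ⟪g t, y t - x t⟫ + L * ∑ t ∈ S, ‖y t - x t‖ ^ 2 := by
  have hproj := sum_norm_sq_add_le_of_nearest S a (fun t => x t - (1 / (2 * L)) • g t) y hmin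
  have hexp : ∀ z : ι → E, L * ∑ t ∈ S, ‖z t - (x t - (1 / (2 * L)) • g t)‖ ^ 2
      = ∑ t ∈ S, ⟪g t, z t - x t⟫ + L * ∑ t ∈ S, ‖z t - x t‖ ^ 2
        + L * ∑ t ∈ S, ‖(1 / (2 * L)) • g t‖ ^ 2 := by
    intro z
    rw [Finset.mul_sum, Finset.mul_sum, Finset.mul_sum, ← Finset.sum_add_distrib,
      ← Finset.sum_add_distrib]
    refine Finset.sum_congr rfl fun t _ => ?_
    rw [show z t - (x t - (1 / (2 * L)) • g t) = (z t - x t) + (1 / (2 * L)) • g t by abel,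
      norm_add_sq_real, inner_smul_right, real_inner_comm]
    field_simp
    ring
  have := mul_le_mul_of_nonneg_left hproj hL.le
  rw [mul_add] at this
  simp only [hexp] at this
  linarith

end InnerProductSpace

theorem sum_Icc_pred_eq {M : Type*} [AddCommMonoid M] (T : ℕ) (F : ℕ → M) (hF : F 0 = 0) :
    ∑ t ∈ Finset.Icc 1 T, F (t - 1) = ∑ t ∈ Finset.Icc 1 T, if t < T then F t else 0 := by
  induction T with
  | zero => simp
  | succ m ih =>
    rw [Finset.sum_Icc_succ_top (by omega), Finset.sum_Icc_succ_top (by omega), ih]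
    rcases Nat.eq_zero_or_pos m with rfl | hm
    · simp [hF]
    · obtain ⟨q, rfl⟩ : ∃ q, m = q + 1 := ⟨m - 1, by omega⟩
      rw [Finset.sum_Icc_succ_top (by omega), Finset.sum_Icc_succ_top (by omega)]
      simp only [lt_irrefl, if_false, add_zero, Nat.add_sub_cancel]
      rw [if_pos (by omega)]
      congr 1
      refine Finset.sum_congr rfl fun t ht => ?_
      have := Finset.mem_Icc.mp ht
      rw [if_pos (by omega), if_pos (by omega)]

theorem sum_inner_socoGrad {n p : ℕ} (T : ℕ)
    (Gf : EuclideanSpace ℝ (Fin n) → EuclideanSpace ℝ (Fin p) → EuclideanSpace ℝ (Fin n))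
    (Gd1 Gd2 : EuclideanSpace ℝ (Fin n) → EuclideanSpace ℝ (Fin n) → EuclideanSpace ℝ (Fin n))
    (θ : ℕ → EuclideanSpace ℝ (Fin p)) (x v : ℕ → EuclideanSpace ℝ (Fin n)) (hv : v 0 = 0) :
    ∑ t ∈ Finset.Icc 1 T, ⟪socoGrad T Gf Gd1 Gd2 θ x t, v t⟫
      = ∑ t ∈ Finset.Icc 1 T, (⟪Gf (x t) (θ t), v t⟫ + ⟪Gd1 (x t) (x (t - 1)), v t⟫
          + ⟪Gd2 (x t) (x (t - 1)), v (t - 1)⟫) := by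
  have hshift := sum_Icc_pred_eq T (fun t => ⟪Gd2 (x (t + 1)) (x t), v t⟫) (by simp [hv])
  have hpred : ∑ t ∈ Finset.Icc 1 T, ⟪Gd2 (x t) (x (t - 1)), v (t - 1)⟫
      = ∑ t ∈ Finset.Icc 1 T, ⟪Gd2 (x (t - 1 + 1)) (x (t - 1)), v (t - 1)⟫ := by
    refine Finset.sum_congr rfl fun t ht => ?_
    rw [Nat.sub_add_cancel (Finset.mem_Icc.mp ht).1]
  rw [Finset.sum_add_distrib, hpred, hshift, ← Finset.sum_add_distrib]
  refine Finset.sum_congr rfl fun t _ => ?_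
  unfold socoGrad
  rw [inner_add_left, inner_add_left]
  split_ifs <;> simp

theorem sum_norm_sq_pred_le {E : Type*} [NormedAddCommGroup E] (T : ℕ) (v : ℕ → E)
    (hv : v 0 = 0) :
    ∑ t ∈ Finset.Icc 1 T, ‖v (t - 1)‖ ^ 2 ≤ ∑ t ∈ Finset.Icc 1 T, ‖v t‖ ^ 2 := by
  rw [sum_Icc_pred_eq T (fun t => ‖v t‖ ^ 2) (by simp [hv])]
  refine Finset.sum_le_sum fun t _ => ?_
  split_ifs
  · exact le_rfl
  · positivity

theorem socoCost_strongly_convex {n p : ℕ} {T : ℕ}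
    {X : Set (EuclideanSpace ℝ (Fin n))} {Θ : Set (EuclideanSpace ℝ (Fin p))}
    {f : EuclideanSpace ℝ (Fin n) → EuclideanSpace ℝ (Fin p) → ℝ}
    {d : EuclideanSpace ℝ (Fin n) → EuclideanSpace ℝ (Fin n) → ℝ}
    {Gf : EuclideanSpace ℝ (Fin n) → EuclideanSpace ℝ (Fin p) → EuclideanSpace ℝ (Fin n)}
    {Gd1 Gd2 : EuclideanSpace ℝ (Fin n) → EuclideanSpace ℝ (Fin n) → EuclideanSpace ℝ (Fin n)}
    {α : ℝ}
    (hfsc : ∀ θ ∈ Θ, ∀ x ∈ X, ∀ y ∈ X,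
      f y θ ≥ f x θ + ⟪Gf x θ, y - x⟫ + α / 2 * ‖y - x‖ ^ 2)
    (hdcv : ∀ a ∈ X, ∀ b ∈ X, ∀ a' ∈ X, ∀ b' ∈ X,
      d a' b' ≥ d a b + ⟪Gd1 a b, a' - a⟫ + ⟪Gd2 a b, b' - b⟫)
    {θ : ℕ → EuclideanSpace ℝ (Fin p)} (hθ : ∀ t ∈ Finset.Icc 1 T, θ t ∈ Θ)
    {x y : ℕ → EuclideanSpace ℝ (Fin n)} (hxX : ∀ t ≤ T, x t ∈ X) (hyX : ∀ t ≤ T, y t ∈ X)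
    (hxy : x 0 = y 0) :
    socoCost T f d θ x + ∑ t ∈ Finset.Icc 1 T, ⟪socoGrad T Gf Gd1 Gd2 θ x t, y t - x t⟫
      + α / 2 * ∑ t ∈ Finset.Icc 1 T, ‖y t - x t‖ ^ 2 ≤ socoCost T f d θ y := by
  rw [sum_inner_socoGrad T Gf Gd1 Gd2 θ x (fun t => y t - x t) (by simp [hxy]), Finset.mul_sum]
  unfold socoCost
  rw [← Finset.sum_add_distrib, ← Finset.sum_add_distrib]
  refine Finset.sum_le_sum fun t ht => ?_
  have htT := (Finset.mem_Icc.mp ht).2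
  have h₁ := hfsc (θ t) (hθ t ht) (x t) (hxX t htT) (y t) (hyX t htT)
  have h₂ := hdcv (x t) (hxX t htT) (x (t - 1)) (hxX _ (by omega)) (y t) (hyX t htT)
    (y (t - 1)) (hyX _ (by omega))
  linarith

theorem sum_inner_socoGrad_sub_le {n p : ℕ} {T : ℕ}
    {X : Set (EuclideanSpace ℝ (Fin n))} {Θ : Set (EuclideanSpace ℝ (Fin p))}
    {Gf : EuclideanSpace ℝ (Fin n) → EuclideanSpace ℝ (Fin p) → EuclideanSpace ℝ (Fin n)}
    {Gd1 Gd2 : EuclideanSpace ℝ (Fin n) → EuclideanSpace ℝ (Fin n) → EuclideanSpace ℝ (Fin n)}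
    {lf ld : ℝ} (hld : 0 ≤ ld)
    (hfsm : ∀ θ ∈ Θ, ∀ x ∈ X, ∀ y ∈ X, ‖Gf x θ - Gf y θ‖ ≤ lf * ‖x - y‖)
    (hdsm : ∀ a ∈ X, ∀ b ∈ X, ∀ a' ∈ X, ∀ b' ∈ X,
      ‖Gd1 a b - Gd1 a' b'‖ ^ 2 + ‖Gd2 a b - Gd2 a' b'‖ ^ 2
        ≤ ld ^ 2 * (‖a - a'‖ ^ 2 + ‖b - b'‖ ^ 2))
    {θ : ℕ → EuclideanSpace ℝ (Fin p)} (hθ : ∀ t ∈ Finset.Icc 1 T, θ t ∈ Θ)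
    {x y : ℕ → EuclideanSpace ℝ (Fin n)} (hxX : ∀ t ≤ T, x t ∈ X) (hyX : ∀ t ≤ T, y t ∈ X)
    (hxy : x 0 = y 0) :
    ∑ t ∈ Finset.Icc 1 T, ⟪socoGrad T Gf Gd1 Gd2 θ y t, y t - x t⟫
      - ∑ t ∈ Finset.Icc 1 T, ⟪socoGrad T Gf Gd1 Gd2 θ x t, y t - x t⟫
      ≤ (lf + 2 * ld) * ∑ t ∈ Finset.Icc 1 T, ‖y t - x t‖ ^ 2 := by
  have hpred := sum_norm_sq_pred_le T (fun t => y t - x t) (by simp [hxy])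
  rw [sum_inner_socoGrad T Gf Gd1 Gd2 θ x (fun t => y t - x t) (by simp [hxy]),
    sum_inner_socoGrad T Gf Gd1 Gd2 θ y (fun t => y t - x t) (by simp [hxy]),
    ← Finset.sum_sub_distrib]
  calc _ ≤ ∑ t ∈ Finset.Icc 1 T,
        ((lf + ld) * ‖y t - x t‖ ^ 2 + ld * ‖y (t - 1) - x (t - 1)‖ ^ 2) := by
        refine Finset.sum_le_sum fun t ht => ?_
        have htT := (Finset.mem_Icc.mp ht).2
        have h₁ := hfsm (θ t) (hθ t ht) (y t) (hyX t htT) (x t) (hxX t htT)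
        have h₂ := inner_add_inner_le_of_sq_add_sq_le _ _ _ _ hld
          (hdsm (y t) (hyX t htT) (y (t - 1)) (hyX _ (by omega)) (x t) (hxX t htT)
            (x (t - 1)) (hxX _ (by omega)))
        have h₃ := real_inner_le_norm (Gf (y t) (θ t) - Gf (x t) (θ t)) (y t - x t)
        have h₄ := mul_le_mul_of_nonneg_right h₁ (norm_nonneg (y t - x t))
        simp only [inner_sub_left] at h₂ h₃
        linarith
    _ ≤ _ := by
        rw [Finset.sum_add_distrib, ← Finset.mul_sum, ← Finset.mul_sum]
        linarith [mul_le_mul_of_nonneg_left hpred hld]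

/-- Quadratic growth at the minimizer of a strongly convex total cost. -/
theorem socoCost_quadratic_growth {n p : ℕ} {T : ℕ}
    {X : Set (EuclideanSpace ℝ (Fin n))} {Θ : Set (EuclideanSpace ℝ (Fin p))}
    (hXcv : Convex ℝ X)
    {f : EuclideanSpace ℝ (Fin n) → EuclideanSpace ℝ (Fin p) → ℝ}
    {d : EuclideanSpace ℝ (Fin n) → EuclideanSpace ℝ (Fin n) → ℝ}
    {Gf : EuclideanSpace ℝ (Fin n) → EuclideanSpace ℝ (Fin p) → EuclideanSpace ℝ (Fin n)}
    {Gd1 Gd2 : EuclideanSpace ℝ (Fin n) → EuclideanSpace ℝ (Fin n) → EuclideanSpace ℝ (Fin n)}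
    {α : ℝ}
    (hfsc : ∀ θ ∈ Θ, ∀ x ∈ X, ∀ y ∈ X,
      f y θ ≥ f x θ + ⟪Gf x θ, y - x⟫ + α / 2 * ‖y - x‖ ^ 2)
    (hdcv : ∀ a ∈ X, ∀ b ∈ X, ∀ a' ∈ X, ∀ b' ∈ X,
      d a' b' ≥ d a b + ⟪Gd1 a b, a' - a⟫ + ⟪Gd2 a b, b' - b⟫)
    {θ : ℕ → EuclideanSpace ℝ (Fin p)} (hθ : ∀ t ∈ Finset.Icc 1 T, θ t ∈ Θ)
    {x y : ℕ → EuclideanSpace ℝ (Fin n)} (hxX : ∀ t ≤ T, x t ∈ X) (hyX : ∀ t ≤ T, y t ∈ X)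
    (hxy : x 0 = y 0)
    (hmin : ∀ w : ℕ → EuclideanSpace ℝ (Fin n), w 0 = x 0 → (∀ t ∈ Finset.Icc 1 T, w t ∈ X) →
      socoCost T f d θ x ≤ socoCost T f d θ w) :
    α / 2 * ∑ t ∈ Finset.Icc 1 T, ‖y t - x t‖ ^ 2
      ≤ socoCost T f d θ y - socoCost T f d θ x := by
  rw [← sub_nonneg]
  refine nonneg_of_forall_add_mul_nonneg
    (Q := α / 2 * ∑ t ∈ Finset.Icc 1 T, ‖y t - x t‖ ^ 2) fun s hs hs1 => ?_
  let z : ℕ → EuclideanSpace ℝ (Fin n) := fun t => x t + s • (y t - x t)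
  have hz0 : z 0 = x 0 := by simp [z, hxy]
  have hzX : ∀ t ≤ T, z t ∈ X := fun t ht =>
    hXcv.add_smul_sub_mem (hxX t ht) (hyX t ht) ⟨hs.le, hs1.le⟩
  have hzx : ∀ t, x t - z t = (-s) • (y t - x t) := fun t => by simp [z]
  have hzy : ∀ t, y t - z t = (1 - s) • (y t - x t) := fun t => by
    simp only [z, sub_smul, one_smul]
    abel
  have h₀ := hmin z hz0 fun t ht => hzX t (Finset.mem_Icc.mp ht).2
  have h₁ := socoCost_strongly_convex hfsc hdcv hθ hzX hxX hz0
  have h₂ := socoCost_strongly_convex hfsc hdcv hθ hzX hyX (hz0.trans hxy)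
  simp only [hzx, hzy, inner_smul_right, norm_smul, mul_pow, Real.norm_eq_abs, sq_abs,
    ← Finset.mul_sum] at h₁ h₂
  have h₃ := mul_le_mul_of_nonneg_left h₁ (sub_nonneg.mpr hs1.le)
  have h₄ := mul_le_mul_of_nonneg_left h₂ hs.le
  refine nonneg_of_mul_nonneg_right (a := s) ?_ hs
  linarith

/-- One projected gradient step with an inexact gradient contracts the distance to any
comparator, up to the squared gradient error. -/
theorem socoCost_projected_step {n p : ℕ} {T : ℕ}
    {X : Set (EuclideanSpace ℝ (Fin n))} {Θ : Set (EuclideanSpace ℝ (Fin p))}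
    (hXcv : Convex ℝ X)
    {f : EuclideanSpace ℝ (Fin n) → EuclideanSpace ℝ (Fin p) → ℝ}
    {d : EuclideanSpace ℝ (Fin n) → EuclideanSpace ℝ (Fin n) → ℝ}
    {Gf : EuclideanSpace ℝ (Fin n) → EuclideanSpace ℝ (Fin p) → EuclideanSpace ℝ (Fin n)}
    {Gd1 Gd2 : EuclideanSpace ℝ (Fin n) → EuclideanSpace ℝ (Fin n) → EuclideanSpace ℝ (Fin n)}
    {α lf ld h : ℝ} (hα : 0 < α) (hld : 0 ≤ ld)
    (hfsc : ∀ θ ∈ Θ, ∀ x ∈ X, ∀ y ∈ X,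
      f y θ ≥ f x θ + ⟪Gf x θ, y - x⟫ + α / 2 * ‖y - x‖ ^ 2)
    (hfsm : ∀ θ ∈ Θ, ∀ x ∈ X, ∀ y ∈ X, ‖Gf x θ - Gf y θ‖ ≤ lf * ‖x - y‖)
    (hdcv : ∀ a ∈ X, ∀ b ∈ X, ∀ a' ∈ X, ∀ b' ∈ X,
      d a' b' ≥ d a b + ⟪Gd1 a b, a' - a⟫ + ⟪Gd2 a b, b' - b⟫)
    (hdsm : ∀ a ∈ X, ∀ b ∈ X, ∀ a' ∈ X, ∀ b' ∈ X,
      ‖Gd1 a b - Gd1 a' b'‖ ^ 2 + ‖Gd2 a b - Gd2 a' b'‖ ^ 2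
        ≤ ld ^ 2 * (‖a - a'‖ ^ 2 + ‖b - b'‖ ^ 2))
    (hlip : ∀ x ∈ X, ∀ θ ∈ Θ, ∀ θ' ∈ Θ, ‖Gf x θ - Gf x θ'‖ ≤ h * ‖θ - θ'‖)
    {L : ℝ} (hLdef : L = lf + 2 * ld) (hL : 0 < L)
    {θ ε : ℕ → EuclideanSpace ℝ (Fin p)} (hθ : ∀ t ∈ Finset.Icc 1 T, θ t ∈ Θ)
    (hpred : ∀ t ∈ Finset.Icc 1 T, θ t - ε t ∈ Θ)
    {x a y : ℕ → EuclideanSpace ℝ (Fin n)} (hxX : ∀ t ≤ T, x t ∈ X) (haX : ∀ t ≤ T, a t ∈ X)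
    (hyX : ∀ t ≤ T, y t ∈ X) (hxy : x 0 = y 0) (hxa : x 0 = a 0)
    (hmin : ∀ w : ℕ → EuclideanSpace ℝ (Fin n), w 0 = a 0 → (∀ t ∈ Finset.Icc 1 T, w t ∈ X) →
      ∑ t ∈ Finset.Icc 1 T,
          ‖a t - (x t - (1 / (2 * L)) • socoGrad T Gf Gd1 Gd2 (fun s => θ s - ε s) x t)‖ ^ 2
        ≤ ∑ t ∈ Finset.Icc 1 T,
          ‖w t - (x t - (1 / (2 * L)) • socoGrad T Gf Gd1 Gd2 (fun s => θ s - ε s) x t)‖ ^ 2) :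
    (L - α / 4) * ∑ t ∈ Finset.Icc 1 T, ‖y t - a t‖ ^ 2
        + (socoCost T f d θ a - socoCost T f d θ y)
      ≤ (L - α / 2) * ∑ t ∈ Finset.Icc 1 T, ‖y t - x t‖ ^ 2
        + h ^ 2 / α * ∑ t ∈ Finset.Icc 1 T, ‖ε t‖ ^ 2 := by
  have hthree := sum_inner_add_le_of_projected_step (Finset.Icc 1 T) a x
    (socoGrad T Gf Gd1 Gd2 (fun s => θ s - ε s) x) y hL fun s hs hs1 =>
      hmin (fun t => a t + s • (y t - a t)) (by simp [← hxy, ← hxa]) fun t ht =>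
        hXcv.add_smul_sub_mem (haX t (Finset.mem_Icc.mp ht).2) (hyX t (Finset.mem_Icc.mp ht).2)
          ⟨hs.le, hs1.le⟩
  have hsm := sum_inner_socoGrad_sub_le hld hfsm hdsm hθ hxX haX hxa
  have hcv := socoCost_strongly_convex hfsc hdcv hθ haX hxX hxa.symm
  have hsc := socoCost_strongly_convex hfsc hdcv hθ hxX hyX hxy
  have hneg : ∑ t ∈ Finset.Icc 1 T, ⟪socoGrad T Gf Gd1 Gd2 θ a t, x t - a t⟫
      = -∑ t ∈ Finset.Icc 1 T, ⟪socoGrad T Gf Gd1 Gd2 θ a t, a t - x t⟫ := by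
    rw [← Finset.sum_neg_distrib]
    refine Finset.sum_congr rfl fun t _ => ?_
    rw [← inner_neg_right, neg_sub]
  have herr : (∑ t ∈ Finset.Icc 1 T,
          ⟪socoGrad T Gf Gd1 Gd2 (fun s => θ s - ε s) x t, y t - x t⟫
        - ∑ t ∈ Finset.Icc 1 T,
          ⟪socoGrad T Gf Gd1 Gd2 (fun s => θ s - ε s) x t, a t - x t⟫)
      - (∑ t ∈ Finset.Icc 1 T, ⟪socoGrad T Gf Gd1 Gd2 θ x t, y t - x t⟫
        - ∑ t ∈ Finset.Icc 1 T, ⟪socoGrad T Gf Gd1 Gd2 θ x t, a t - x t⟫)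
      ≤ h ^ 2 / α * ∑ t ∈ Finset.Icc 1 T, ‖ε t‖ ^ 2
        + α / 4 * ∑ t ∈ Finset.Icc 1 T, ‖y t - a t‖ ^ 2 := by
    rw [Finset.mul_sum, Finset.mul_sum, ← Finset.sum_add_distrib, ← Finset.sum_sub_distrib,
      ← Finset.sum_sub_distrib, ← Finset.sum_sub_distrib]
    refine Finset.sum_le_sum fun t ht => ?_
    have h₁ := hlip (x t) (hxX t (Finset.mem_Icc.mp ht).2) _ (hpred t ht) _ (hθ t ht)
    rw [show θ t - ε t - θ t = -ε t by abel, norm_neg] at h₁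
    have h₂ := inner_le_sq_div_add (Gf (x t) (θ t - ε t) - Gf (x t) (θ t)) (y t - a t) hα
    have h₃ : ‖Gf (x t) (θ t - ε t) - Gf (x t) (θ t)‖ ^ 2 / α ≤ h ^ 2 / α * ‖ε t‖ ^ 2 := by
      rw [div_mul_eq_mul_div, ← mul_pow]
      gcongr
    refine le_trans (le_of_eq ?_) (h₂.trans (add_le_add_left h₃ _))
    rw [← inner_sub_right, ← inner_sub_right, ← inner_sub_left]
    congr 1
    · simp only [socoGrad]
      abel
    · abel
  have hnn : 0 ≤ α / 2 * ∑ t ∈ Finset.Icc 1 T, ‖x t - a t‖ ^ 2 := by positivity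
  rw [← hLdef] at hsm
  linarith

/-- Unrolling a perturbed linear recursion driven by a time-reversed error sequence. -/
theorem unroll_contraction {u v b : ℕ → ℝ} {ρ : ℝ} {W : ℕ} (hρ : 0 ≤ ρ)
    (hv : ∀ k ≤ W, 0 ≤ v k)
    (hstep : ∀ k < W, u (k + 1) + v (k + 1) ≤ ρ * u k + b (W - k)) (m : ℕ) (hm : m < W) :
    u (m + 1) + v (m + 1)
      ≤ ρ ^ (m + 1) * u 0 + ∑ j ∈ Finset.range (m + 1), ρ ^ j * b (W - m + j) := by
  induction m with
  | zero => simpa using hstep 0 hm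
  | succ m ih =>
    have h₁ := hstep (m + 1) hm
    have h₂ : u (m + 1)
        ≤ ρ ^ (m + 1) * u 0 + ∑ j ∈ Finset.range (m + 1), ρ ^ j * b (W - m + j) := by
      linarith [ih (by omega), hv (m + 1) hm.le]
    have h₃ := mul_le_mul_of_nonneg_left h₂ hρ
    have h₄ : ∑ j ∈ Finset.range (m + 1 + 1), ρ ^ j * b (W - (m + 1) + j)
        = ρ * ∑ j ∈ Finset.range (m + 1), ρ ^ j * b (W - m + j) + b (W - (m + 1)) := by
      rw [Finset.sum_range_succ', Finset.mul_sum]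
      simp only [pow_zero, one_mul, add_zero]
      congr 1
      refine Finset.sum_congr rfl fun j _ => ?_
      rw [show W - (m + 1) + (j + 1) = W - m + j by omega]
      ring
    rw [h₄, pow_succ']
    linarith

theorem sum_Icc_pow_mul_of_eventually_const {b : ℕ → ℝ} {ρ : ℝ} (hρ : ρ ≠ 1) {T : ℕ}
    (hb : ∀ j, T < j → b j = b T) (W : ℕ) :
    ∑ j ∈ Finset.range W, ρ ^ j * b (1 + j)
      = ∑ k ∈ Finset.Icc 1 (min W T), ρ ^ (k - 1) * b k
        + if T < W then (ρ ^ T - ρ ^ W) / (1 - ρ) * b T else 0 := by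
  have hρ' : 1 - ρ ≠ 0 := sub_ne_zero.mpr hρ.symm
  induction W with
  | zero => simp
  | succ W ih =>
    rw [Finset.sum_range_succ, ih]
    rcases lt_or_ge W T with hW | hW
    · rw [min_eq_left hW.le, min_eq_left hW, if_neg (by omega), if_neg (by omega),
        Finset.sum_Icc_succ_top (by omega), add_comm 1 W]
      simp
    · rw [min_eq_right hW, min_eq_right (by omega), if_pos (by omega : T < W + 1),
        hb (1 + W) (by omega)]
      rcases hW.eq_or_lt with rfl | hW
      · rw [if_neg (lt_irrefl _)]
        field_simp
        ring
      · rw [if_pos hW]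
        field_simp
        ring

/-- **Theorem 1: general regret bound for RHIG.** Under Assumptions 1 and 2, fix
`W ≥ 0`, stepsize `η = 1/(2L)`, prediction-error vectors `δ(1),…,δ(T) ∈ ℝ^{pT}` (stacked as
`δ k t` for stage `t`) with the convention `δ(j) = δ(T)` for `j > T`, and an initialization
`x(0) ∈ X^T` produced by an arbitrary oracle. The RHIG iterates
`x(k) = Π_{X^T}[x(k−1) − η ∇_x C(x(k−1); θ − δ(W−k+1))]`, `k = 1,…,W`, with
`θ − δ(j) ∈ Θ^T` for all `j`, satisfy
`C(x(W);θ) − C(x*;θ) ≤ (2L/α) ρ^W [C(x(0);θ) − C(x*;θ)]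
  + ζ ∑_{k=1}^{min(W,T)} ρ^{k−1} ‖δ(k)‖² + 1_{W>T} ζ (ρ^T − ρ^W)/(1−ρ) ‖δ(T)‖²`,
where `x* = argmin_{x ∈ X^T} C(x;θ)`, `ρ = 1 − α/(4L)`, `ζ = h²/α + h²/(2L)`. -/
theorem stmt7 {n p : ℕ} (T : ℕ) (hT : 1 ≤ T)
    (X : Set (EuclideanSpace ℝ (Fin n))) (Θ : Set (EuclideanSpace ℝ (Fin p)))
    (hXne : X.Nonempty) (hXcl : IsClosed X) (hXcv : Convex ℝ X)
    (x₀ : EuclideanSpace ℝ (Fin n)) (hx₀ : x₀ ∈ X)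
    (f : EuclideanSpace ℝ (Fin n) → EuclideanSpace ℝ (Fin p) → ℝ)
    (d : EuclideanSpace ℝ (Fin n) → EuclideanSpace ℝ (Fin n) → ℝ)
    (Gf : EuclideanSpace ℝ (Fin n) → EuclideanSpace ℝ (Fin p) → EuclideanSpace ℝ (Fin n))
    (Gd1 Gd2 : EuclideanSpace ℝ (Fin n) → EuclideanSpace ℝ (Fin n) → EuclideanSpace ℝ (Fin n))
    (α lf ld h : ℝ) (hα : 0 < α) (hlf : 0 ≤ lf) (hld : 0 ≤ ld)
    -- Assumption 1: `f(·;θ)` is `α`-strongly convex on `X` for every `θ ∈ Θ`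
    (hfsc : ∀ θ ∈ Θ, ∀ x ∈ X, ∀ y ∈ X,
      f y θ ≥ f x θ + ⟪Gf x θ, y - x⟫ + α / 2 * ‖y - x‖ ^ 2)
    -- Assumption 1: `f(·;θ)` is `l_f`-smooth on `X` for every `θ ∈ Θ`
    (hfsm : ∀ θ ∈ Θ, ∀ x ∈ X, ∀ y ∈ X, ‖Gf x θ - Gf y θ‖ ≤ lf * ‖x - y‖)
    -- Assumption 1: `d` is jointly convex on `X × X`
    (hdcv : ∀ a ∈ X, ∀ b ∈ X, ∀ a' ∈ X, ∀ b' ∈ X,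
      d a' b' ≥ d a b + ⟪Gd1 a b, a' - a⟫ + ⟪Gd2 a b, b' - b⟫)
    -- Assumption 1: `d` is `l_d`-smooth on `X × X` (Euclidean norm on the product)
    (hdsm : ∀ a ∈ X, ∀ b ∈ X, ∀ a' ∈ X, ∀ b' ∈ X,
      ‖Gd1 a b - Gd1 a' b'‖ ^ 2 + ‖Gd2 a b - Gd2 a' b'‖ ^ 2
        ≤ ld ^ 2 * (‖a - a'‖ ^ 2 + ‖b - b'‖ ^ 2))
    -- Assumption 2: `∇_x f(x;·)` is `h`-Lipschitz in the parameter
    (hlip : ∀ x ∈ X, ∀ θ ∈ Θ, ∀ θ' ∈ Θ, ‖Gf x θ - Gf x θ'‖ ≤ h * ‖θ - θ'‖)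
    (L ρ ζ : ℝ) (hLdef : L = lf + 2 * ld) (hαL : α ≤ L)
    (hρdef : ρ = 1 - α / (4 * L)) (hζdef : ζ = h ^ 2 / α + h ^ 2 / (2 * L))
    (W : ℕ)
    (θ : ℕ → EuclideanSpace ℝ (Fin p)) (hθ : ∀ t ∈ Finset.Icc 1 T, θ t ∈ Θ)
    -- prediction errors `δ k t = δ_t(k)`, with the convention `δ(j) = δ(T)` for `j > T`
    (δ : ℕ → ℕ → EuclideanSpace ℝ (Fin p))
    (hδconv : ∀ j, T < j → ∀ t, δ j t = δ T t)
    -- the predicted parameters `θ − δ(j)` lie in `Θ^T`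
    (hpred : ∀ j, ∀ t ∈ Finset.Icc 1 T, θ t - δ j t ∈ Θ)
    -- `x* = argmin_{x ∈ X^T} C(x;θ)`
    (xstar : ℕ → EuclideanSpace ℝ (Fin n))
    (hxstar0 : xstar 0 = x₀) (hxstarX : ∀ t ∈ Finset.Icc 1 T, xstar t ∈ X)
    (hxstaropt : ∀ w : ℕ → EuclideanSpace ℝ (Fin n),
      w 0 = x₀ → (∀ t ∈ Finset.Icc 1 T, w t ∈ X) →
      socoCost T f d θ xstar ≤ socoCost T f d θ w)
    -- the RHIG iterates `x 0, x 1, …, x W`, each a sequence in `X^T`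
    (x : ℕ → ℕ → EuclideanSpace ℝ (Fin n))
    (hx0 : ∀ k, k ≤ W → x k 0 = x₀)
    (hxX : ∀ k, k ≤ W → ∀ t ∈ Finset.Icc 1 T, x k t ∈ X)
    -- `x(k) = Π_{X^T}[x(k−1) − (1/(2L)) ∇_x C(x(k−1); θ − δ(W−k+1))]` for `k = 1,…,W`,
    -- where the projection is characterized as the nearest point of `X^T`
    (hiter : ∀ k, 1 ≤ k → k ≤ W →
      ∀ w : ℕ → EuclideanSpace ℝ (Fin n),
        w 0 = x₀ → (∀ t ∈ Finset.Icc 1 T, w t ∈ X) →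
        ∑ t ∈ Finset.Icc 1 T,
            ‖x k t - (x (k - 1) t
              - (1 / (2 * L)) •
                socoGrad T Gf Gd1 Gd2 (fun s => θ s - δ (W - k + 1) s) (x (k - 1)) t)‖ ^ 2
          ≤ ∑ t ∈ Finset.Icc 1 T,
            ‖w t - (x (k - 1) t
              - (1 / (2 * L)) •
                socoGrad T Gf Gd1 Gd2 (fun s => θ s - δ (W - k + 1) s) (x (k - 1)) t)‖ ^ 2) :
    socoCost T f d θ (x W) - socoCost T f d θ xstar
      ≤ 2 * L / α * ρ ^ W * (socoCost T f d θ (x 0) - socoCost T f d θ xstar)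
        + ζ * ∑ k ∈ Finset.Icc 1 (min W T),
            ρ ^ (k - 1) * ∑ t ∈ Finset.Icc 1 T, ‖δ k t‖ ^ 2
        + (if T < W then
            ζ * ((ρ ^ T - ρ ^ W) / (1 - ρ)) * ∑ t ∈ Finset.Icc 1 T, ‖δ T t‖ ^ 2
          else 0) := by
  have hL : 0 < L := hα.trans_le hαL
  have hext : ∀ {w : ℕ → EuclideanSpace ℝ (Fin n)}, w 0 = x₀ →
      (∀ t ∈ Finset.Icc 1 T, w t ∈ X) → ∀ t ≤ T, w t ∈ X := by
    intro w hw0 hwX t ht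
    rcases Nat.eq_zero_or_pos t with rfl | htpos
    · rwa [hw0]
    · exact hwX t (Finset.mem_Icc.mpr ⟨htpos, ht⟩)
  have hsX := hext hxstar0 hxstarX
  have hxX' : ∀ k ≤ W, ∀ t ≤ T, x k t ∈ X := fun k hk => hext (hx0 k hk) (hxX k hk)
  have hρ0 : 0 ≤ ρ := by
    rw [hρdef, sub_nonneg, div_le_one (by positivity)]
    linarith
  have hρ1 : ρ ≠ 1 := by
    have : 0 < α / (4 * L) := by positivity
    linarith
  have hgap : ∀ k ≤ W, 0 ≤ socoCost T f d θ (x k) - socoCost T f d θ xstar := fun k hk =>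
    sub_nonneg.mpr (hxstaropt (x k) (hx0 k hk) (hxX k hk))
  have hcontract : L - α / 2 ≤ ρ * (L - α / 4) := by
    have h₁ : ρ * (L - α / 4) = L - α / 2 + α / (4 * L) * (α / 4) := by
      rw [hρdef]
      field_simp
      ring
    have : 0 ≤ α / (4 * L) * (α / 4) := by positivity
    linarith
  have hζ : h ^ 2 / α ≤ ζ := by
    rw [hζdef]
    have : 0 ≤ h ^ 2 / (2 * L) := by positivity
    linarith
  have hstep : ∀ k < W,
      (L - α / 4) * ∑ t ∈ Finset.Icc 1 T, ‖xstar t - x (k + 1) t‖ ^ 2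
          + (socoCost T f d θ (x (k + 1)) - socoCost T f d θ xstar)
        ≤ ρ * ((L - α / 4) * ∑ t ∈ Finset.Icc 1 T, ‖xstar t - x k t‖ ^ 2)
          + ζ * ∑ t ∈ Finset.Icc 1 T, ‖δ (W - k) t‖ ^ 2 := by
    intro k hk
    have hproj := hiter (k + 1) (by omega) hk
    rw [show W - (k + 1) + 1 = W - k by omega, Nat.add_sub_cancel] at hproj
    have h₁ := socoCost_projected_step hXcv hα hld hfsc hfsm hdcv hdsm hlip hLdef hL hθ
      (hpred (W - k)) (hxX' k hk.le) (hxX' (k + 1) hk) hsX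
      ((hx0 k hk.le).trans hxstar0.symm) ((hx0 k hk.le).trans (hx0 (k + 1) hk).symm)
      (fun w hw => hproj w (hw.trans (hx0 (k + 1) hk)))
    refine h₁.trans (add_le_add ?_ ?_)
    · rw [← mul_assoc]
      gcongr
    · gcongr
  have hgrowth := socoCost_quadratic_growth hXcv hfsc hdcv hθ hsX (hxX' 0 (Nat.zero_le W))
    (hxstar0.trans (hx0 0 (Nat.zero_le W)).symm) (fun w hw => hxstaropt w (hw.trans hxstar0))
  simp only [norm_sub_rev (x 0 _)] at hgrowth
  have hinit : (L - α / 4) * ∑ t ∈ Finset.Icc 1 T, ‖xstar t - x 0 t‖ ^ 2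
      ≤ 2 * L / α * (socoCost T f d θ (x 0) - socoCost T f d θ xstar) := by
    calc _ ≤ L * ∑ t ∈ Finset.Icc 1 T, ‖xstar t - x 0 t‖ ^ 2 := by
          gcongr
          linarith
      _ = 2 * L / α * (α / 2 * ∑ t ∈ Finset.Icc 1 T, ‖xstar t - x 0 t‖ ^ 2) := by
          field_simp
      _ ≤ _ := by gcongr
  have hsum := sum_Icc_pow_mul_of_eventually_const
    (b := fun k => ζ * ∑ t ∈ Finset.Icc 1 T, ‖δ k t‖ ^ 2) hρ1 (T := T)
    (fun j hj => by simp only [hδconv j hj]) W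
  have hrhs : ∑ j ∈ Finset.range W, ρ ^ j * (ζ * ∑ t ∈ Finset.Icc 1 T, ‖δ (1 + j) t‖ ^ 2)
      = ζ * ∑ k ∈ Finset.Icc 1 (min W T), ρ ^ (k - 1) * ∑ t ∈ Finset.Icc 1 T, ‖δ k t‖ ^ 2
        + (if T < W then
            ζ * ((ρ ^ T - ρ ^ W) / (1 - ρ)) * ∑ t ∈ Finset.Icc 1 T, ‖δ T t‖ ^ 2
          else 0) := by
    rw [hsum]
    congr 1
    · rw [Finset.mul_sum]
      exact Finset.sum_congr rfl fun k _ => mul_left_comm _ _ _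
    · split_ifs
      · ring
      · rfl
  rw [add_assoc, ← hrhs]
  rcases W with _ | m
  · have h₁ : 1 ≤ 2 * L / α := by
      rw [one_le_div hα]
      linarith
    simpa using le_mul_of_one_le_left (hgap 0 le_rfl) h₁
  · have hunroll := unroll_contraction
      (u := fun k => (L - α / 4) * ∑ t ∈ Finset.Icc 1 T, ‖xstar t - x k t‖ ^ 2)
      (v := fun k => socoCost T f d θ (x k) - socoCost T f d θ xstar)
      (b := fun k => ζ * ∑ t ∈ Finset.Icc 1 T, ‖δ k t‖ ^ 2) hρ0 hgap hstep m (Nat.lt_succ_self m)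
    simp only [Nat.add_sub_cancel_left] at hunroll
    have h₁ : 0 ≤ (L - α / 4) * ∑ t ∈ Finset.Icc 1 T, ‖xstar t - x (m + 1) t‖ ^ 2 :=
      mul_nonneg (by linarith) (by positivity)
    have h₂ := mul_le_mul_of_nonneg_left hinit (pow_nonneg hρ0 (m + 1))
    linarith
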